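/- arXiv:2112.00130 — 3 statements merged into one kernel-verified Lean document; each statement's English description precedes it below -/
import Mathlib

section
/- Let H(R,S) = (S₁² + S₂² + 2S₃²)/2 + R₁ and K(R,S) = (S₁²/2 − S₂²/2 − R₁)² + (S₁S₂ − R₂)². Then the Lie–Poisson bracket of H and K vanishes identically on ℝ⁶: {H, K}(R,S) = 0 for all (R,S) ∈ ℝ⁶. (This is the commutation of the Kovalevskaya Hamiltonian with the Kovalevskaya integral.) -/
open Matrix

/-- Phase space ℝ⁶ = {(R,S)} with R,S ∈ ℝ³. -/
abbrev E3 : Type := (Fin 3 → ℝ) × (Fin 3 → ℝ)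

/-- Gradient in the R-variables (vector of partial derivatives). -/
noncomputable def gradR (f : E3 → ℝ) (p : E3) : Fin 3 → ℝ :=
  fun i => fderiv ℝ f p (Pi.single i 1, 0)

/-- Gradient in the S-variables (vector of partial derivatives). -/
noncomputable def gradS (f : E3 → ℝ) (p : E3) : Fin 3 → ℝ :=
  fun i => fderiv ℝ f p (0, Pi.single i 1)

/-- The Lie–Poisson bracket of e(3)*:
`{f,g}(R,S) = S · (∇_S f × ∇_S g) + R · (∇_S f × ∇_R g − ∇_S g × ∇_R f)`. -/
noncomputable def e3Bracket (f g : E3 → ℝ) (p : E3) : ℝ :=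
  p.2 ⬝ᵥ (crossProduct (gradS f p) (gradS g p)) +
    p.1 ⬝ᵥ (crossProduct (gradS f p) (gradR g p) - crossProduct (gradS g p) (gradR f p))

/-- The Kovalevskaya Hamiltonian `H(R,S) = (S₁² + S₂² + 2S₃²)/2 + R₁`. -/
noncomputable def Hkov : E3 → ℝ :=
  fun p => (p.2 0 ^ 2 + p.2 1 ^ 2 + 2 * p.2 2 ^ 2) / 2 + p.1 0

/-- The Kovalevskaya integral `K(R,S) = (S₁²/2 − S₂²/2 − R₁)² + (S₁S₂ − R₂)²`. -/
noncomputable def Kkov : E3 → ℝ :=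
  fun p => (p.2 0 ^ 2 / 2 - p.2 1 ^ 2 / 2 - p.1 0) ^ 2 + (p.2 0 * p.2 1 - p.1 1) ^ 2


/-- The `i`-th coordinate of `R`, as a continuous linear functional. -/
noncomputable def coordR (i : Fin 3) : E3 →L[ℝ] ℝ :=
  (ContinuousLinearMap.proj i).comp (ContinuousLinearMap.fst ℝ (Fin 3 → ℝ) (Fin 3 → ℝ))

/-- The `i`-th coordinate of `S`, as a continuous linear functional. -/
noncomputable def coordS (i : Fin 3) : E3 →L[ℝ] ℝ :=
  (ContinuousLinearMap.proj i).comp (ContinuousLinearMap.snd ℝ (Fin 3 → ℝ) (Fin 3 → ℝ))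

theorem coordR_apply (i : Fin 3) (v : E3) : coordR i v = v.1 i := rfl

theorem coordS_apply (i : Fin 3) (v : E3) : coordS i v = v.2 i := rfl

theorem hasFDerivAt_coordR (i : Fin 3) (p : E3) :
    HasFDerivAt (fun q : E3 => q.1 i) (coordR i) p := (coordR i).hasFDerivAt

theorem hasFDerivAt_coordS (i : Fin 3) (p : E3) :
    HasFDerivAt (fun q : E3 => q.2 i) (coordS i) p := (coordS i).hasFDerivAt

theorem fderiv_Hkov_apply (p v : E3) :
    fderiv ℝ Hkov p v = p.2 0 * v.2 0 + p.2 1 * v.2 1 + 2 * p.2 2 * v.2 2 + v.1 0 := by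
  have h := (((((hasFDerivAt_coordS 0 p).pow 2).add ((hasFDerivAt_coordS 1 p).pow 2)).add
    (((hasFDerivAt_coordS 2 p).pow 2).const_mul 2)).mul_const (2⁻¹ : ℝ)).add
    (hasFDerivAt_coordR 0 p)
  rw [HasFDerivAt.fderiv (f := Hkov) h]
  simp [coordR_apply, coordS_apply]
  ring

theorem fderiv_Kkov_apply (p v : E3) :
    fderiv ℝ Kkov p v =
      2 * (p.2 0 ^ 2 / 2 - p.2 1 ^ 2 / 2 - p.1 0) * (p.2 0 * v.2 0 - p.2 1 * v.2 1 - v.1 0) +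
        2 * (p.2 0 * p.2 1 - p.1 1) * (p.2 0 * v.2 1 + p.2 1 * v.2 0 - v.1 1) := by
  have h := ((((((hasFDerivAt_coordS 0 p).pow 2).mul_const (2⁻¹ : ℝ)).sub
    (((hasFDerivAt_coordS 1 p).pow 2).mul_const (2⁻¹ : ℝ))).sub
    (hasFDerivAt_coordR 0 p)).pow 2).add
    ((((hasFDerivAt_coordS 0 p).mul (hasFDerivAt_coordS 1 p)).sub
    (hasFDerivAt_coordR 1 p)).pow 2)
  rw [HasFDerivAt.fderiv (f := Kkov) h]
  simp [coordR_apply, coordS_apply]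
  ring

/-- The Lie–Poisson bracket of the Kovalevskaya Hamiltonian `H` and the Kovalevskaya
integral `K` vanishes identically on ℝ⁶. -/
theorem kovalevskaya_H_K_poisson_commute : ∀ p : E3, e3Bracket Hkov Kkov p = 0 := by
  intro p
  simp [e3Bracket, gradR, gradS, fderiv_Hkov_apply, fderiv_Kkov_apply, cross_apply,
    dotProduct, Fin.sum_univ_three]
  ring
end

section
/- (Hadamard rescaling lemma for analytic functions.) Let f : ℝ^m → ℝ be real-analytic on an open ball B(0,ρ) around the origin with f(0) = 0 and with vanishing first derivative Df(0) = 0. Then there exist δ > 0 and a function g : ℝ^m × ℝ → ℝ, real-analytic on the open set {(w,s) : ‖w‖ < 1, |s| < δ}, such that f(s·w) = s²·g(w,s) for all w with ‖w‖ < 1 and all s with |s| < δ. -/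
open Metric Filter Topology

section

variable {𝕜 E F : Type*} [NontriviallyNormedField 𝕜] [NormedAddCommGroup E] [NormedSpace 𝕜 E]
  [NormedAddCommGroup F] [NormedSpace 𝕜 F]

/-- A function analytic at `x` is, near `x`, of the form `y ↦ f x + L y (y - x)` for a function `L`
analytic at `x` with values in continuous linear maps. -/
theorem AnalyticAt.exists_eventually_eq_add_clm_apply_sub [CompleteSpace F] {f : E → F} {x : E}
    (hf : AnalyticAt 𝕜 f x) :
    ∃ L : E → E →L[𝕜] F, AnalyticAt 𝕜 L x ∧ ∀ᶠ y in 𝓝 x, f y = f x + L y (y - x) := by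
  obtain ⟨p, r, hp⟩ := hf
  have hL : HasFPowerSeriesOnBall (fun y ↦ p.shift.sum (y - x)) p.shift x r := by
    have hpos : 0 < p.shift.radius := by
      rw [p.radius_shift]; exact hp.r_pos.trans_le hp.r_le
    have h := (p.shift.hasFPowerSeriesOnBall hpos).comp_sub x
    rw [zero_add, p.radius_shift] at h
    exact h.mono hp.r_pos hp.r_le
  refine ⟨_, hL.analyticAt, ?_⟩
  filter_upwards [eball_mem_nhds x hp.r_pos] with y hy
  have h₁ := hp.hasSum_sub hy
  have h₂ := (hL.unshift (z := f x)).hasSum_sub hy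
  refine h₁.unique (h₂.congr_fun ?_)
  rintro (_ | n)
  · simpa [FormalMultilinearSeries.unshift] using hp.coeff_zero _
  · simp [FormalMultilinearSeries.unshift, FormalMultilinearSeries.shift]

/-- If `f` agrees near `x` with `y ↦ c + L y (y - x)`, then its derivative at `x` is `L x`. -/
theorem fderiv_eq_of_eventually_eq_add_clm_apply_sub {f : E → F} {L : E → E →L[𝕜] F} {x : E} {c : F}
    (hL : DifferentiableAt 𝕜 L x) (h : ∀ᶠ y in 𝓝 x, f y = c + L y (y - x)) :
    fderiv 𝕜 f x = L x := by
  have hd := (hL.hasFDerivAt.clm_apply ((hasFDerivAt_id (𝕜 := 𝕜) x).sub_const x)).const_add c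
  rw [EventuallyEq.fderiv_eq h]
  refine (hd.fderiv (f := fun y ↦ c + L y (y - x))).trans ?_
  ext v
  simp

/-- The pointwise application of an analytic family of continuous linear maps to an analytic
family of vectors is analytic. -/
theorem AnalyticAt.clm_apply_of_analyticAt {G : Type*} [NormedAddCommGroup G] [NormedSpace 𝕜 G]
    {L : G → E →L[𝕜] F} {v : G → E} {x : G} (hL : AnalyticAt 𝕜 L x) (hv : AnalyticAt 𝕜 v x) :
    AnalyticAt 𝕜 (fun y ↦ L y (v y)) x :=
  ((ContinuousLinearMap.id 𝕜 (E →L[𝕜] F)).analyticAt_bilinear (L x, v x)).comp₂ hL hv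

end

/-- Hadamard rescaling lemma for analytic functions: if `f : ℝ^m → ℝ` is real-analytic
on a ball `B(0,ρ)` with `f(0) = 0` and `Df(0) = 0`, then there are `δ > 0` and a
function `g(w,s)`, real-analytic on `{‖w‖ < 1, |s| < δ}`, with
`f(s·w) = s²·g(w,s)` there. -/
theorem hadamard_rescaling (m : ℕ) (ρ : ℝ) (hρ : 0 < ρ)
    (f : EuclideanSpace ℝ (Fin m) → ℝ)
    (hf : AnalyticOnNhd ℝ f (Metric.ball 0 ρ))
    (hf0 : f 0 = 0) (hdf : fderiv ℝ f 0 = 0) :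
    ∃ δ > 0, ∃ g : EuclideanSpace ℝ (Fin m) × ℝ → ℝ,
      AnalyticOnNhd ℝ g {ws : EuclideanSpace ℝ (Fin m) × ℝ | ‖ws.1‖ < 1 ∧ |ws.2| < δ} ∧
      ∀ (w : EuclideanSpace ℝ (Fin m)) (s : ℝ), ‖w‖ < 1 → |s| < δ →
        f (s • w) = s ^ 2 * g (w, s) := by
  obtain ⟨L, hLa, hL⟩ := (hf 0 (mem_ball_self hρ)).exists_eventually_eq_add_clm_apply_sub
  obtain ⟨M, hMa, hM⟩ := hLa.exists_eventually_eq_add_clm_apply_sub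
  have hL0 : L 0 = 0 :=
    (fderiv_eq_of_eventually_eq_add_clm_apply_sub hLa.differentiableAt hL).symm.trans hdf
  obtain ⟨δ, hδ, h⟩ := Metric.eventually_nhds_iff.1 (hL.and (hM.and hMa.eventually_analyticAt))
  simp only [dist_zero_right, hf0, hL0, sub_zero, zero_add] at h
  have hsw (w : EuclideanSpace ℝ (Fin m)) (s : ℝ) (hw : ‖w‖ < 1) (hs : |s| < δ) :
      ‖s • w‖ < δ := by
    rw [norm_smul, Real.norm_eq_abs]
    exact (mul_le_of_le_one_right (abs_nonneg s) hw.le).trans_lt hs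
  refine ⟨δ, hδ, fun ws ↦ M (ws.2 • ws.1) ws.1 ws.1, ?_, fun w s hw hs ↦ ?_⟩
  · rintro ⟨w, s⟩ ⟨hw, hs⟩
    have hM' : AnalyticAt ℝ (fun ws : EuclideanSpace ℝ (Fin m) × ℝ ↦ M (ws.2 • ws.1)) (w, s) :=
      AnalyticAt.fun_comp (h (hsw w s hw hs)).2.2 (analyticAt_snd.smul analyticAt_fst)
    exact (hM'.clm_apply_of_analyticAt analyticAt_fst).clm_apply_of_analyticAt analyticAt_fst
  · obtain ⟨h₁, h₂, -⟩ := h (hsw w s hw hs)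
    rw [h₁, h₂]
    simp only [map_smul, smul_apply, smul_eq_mul]
    ring
end

section
/- (Properness of the momentum map implies completeness of the flows.) Let v : ℝ^d → ℝ^d be a continuously differentiable vector field and let F : ℝ^d → ℝ^m be a continuously differentiable proper map (preimages of compact sets are compact) which is a first integral of v, i.e. DF(p)(v(p)) = 0 for every p ∈ ℝ^d, where DF(p) is the total derivative of F at p. Then the flow of v is complete: for every p₀ ∈ ℝ^d there exists a curve γ : ℝ → ℝ^d, defined on all of ℝ, with γ(0) = p₀ and γ'(t) = v(γ(t)) for all t ∈ ℝ. -/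
open Set Metric Topology
open scoped NNReal

/-- A bounded, globally Lipschitz vector field on a Banach space is complete. -/
theorem LipschitzWith.exists_forall_hasDerivAt_of_bounded {E : Type*} [NormedAddCommGroup E]
    [NormedSpace ℝ E] [CompleteSpace E] {w : E → E} {K L : ℝ≥0} (hw : LipschitzWith K w)
    (hL : ∀ x, ‖w x‖ ≤ L) (x : E) :
    ∃ γ : ℝ → E, γ 0 = x ∧ ∀ t, HasDerivAt γ (w (γ t)) t := by
  have hloc (a : ℝ) (ha : 0 < a) :
      ∃ γ : ℝ → E, γ 0 = x ∧ ∀ t ∈ Ioo (-a) a, HasDerivAt γ (w (γ t)) t := by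
    have hpl : IsPicardLindelof (fun _ ↦ w) (tmin := -a) (tmax := a)
        ⟨0, by constructor <;> linarith⟩ x (L * a.toNNReal) 0 L K :=
      .of_time_independent (fun y _ ↦ hL y) hw.lipschitzOnWith (by simp [ha.le])
    obtain ⟨γ, hγ0, hγ⟩ := hpl.exists_eq_forall_mem_Icc_hasDerivWithinAt₀
    exact ⟨γ, hγ0, fun t ht ↦
      (hγ t (Ioo_subset_Icc_self ht)).hasDerivAt (Icc_mem_nhds ht.1 ht.2)⟩
  choose! γ hγ0 hγ using hloc
  have huniq {a b : ℝ} (ha : 0 < a) (hb : 0 < b) {t : ℝ} (hta : |t| < a) (htb : |t| < b) :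
      γ a t = γ b t := by
    have hc : 0 < min a b := lt_min ha hb
    have hsub {c : ℝ} (hc : min a b ≤ c) : Ioo (-min a b) (min a b) ⊆ Ioo (-c) c :=
      Ioo_subset_Ioo (neg_le_neg hc) hc
    exact ODE_solution_unique_of_mem_Ioo (v := fun _ ↦ w) (s := fun _ ↦ univ) (t₀ := 0)
      (fun _ _ ↦ hw.lipschitzOnWith) ⟨neg_lt_zero.mpr hc, hc⟩
      (fun s hs ↦ ⟨hγ a ha s (hsub (min_le_left _ _) hs), mem_univ _⟩)
      (fun s hs ↦ ⟨hγ b hb s (hsub (min_le_right _ _) hs), mem_univ _⟩)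
      (by rw [hγ0 a ha, hγ0 b hb]) (abs_lt.mp (lt_min hta htb))
  refine ⟨fun t ↦ γ (|t| + 1) t, hγ0 _ (by positivity), fun t ↦ ?_⟩
  have ht : |t| < |t| + 1 := lt_add_one _
  refine (hγ (|t| + 1) (by positivity) t (abs_lt.mp ht)).congr_of_eventuallyEq ?_
  filter_upwards [continuous_abs.continuousAt.eventually_lt_const ht] with s hs
  exact huniq (by positivity) (by positivity) (lt_add_one _) hs

/-- A compactly supported `C¹` vector field on a Banach space is complete. -/
theorem HasCompactSupport.exists_forall_hasDerivAt_of_contDiff {E : Type*} [NormedAddCommGroup E]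
    [NormedSpace ℝ E] [CompleteSpace E] {w : E → E} (hw : HasCompactSupport w)
    (hw' : ContDiff ℝ 1 w) (x : E) :
    ∃ γ : ℝ → E, γ 0 = x ∧ ∀ t, HasDerivAt γ (w (γ t)) t := by
  obtain ⟨K, hK⟩ := ContDiff.lipschitzWith_of_hasCompactSupport hw hw' one_ne_zero
  obtain ⟨L, hL⟩ := hw.exists_bound_of_continuous hw'.continuous
  exact hK.exists_forall_hasDerivAt_of_bounded (L := L.toNNReal)
    (fun y ↦ (hL y).trans (Real.le_coe_toNNReal L)) x

/-- A first integral of a vector field is constant along its integral curves. -/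
theorem apply_eq_of_fderiv_apply_eq_zero {E G : Type*} [NormedAddCommGroup E] [NormedSpace ℝ E]
    [NormedAddCommGroup G] [NormedSpace ℝ G] {w : E → E} {F : E → G} (hF : Differentiable ℝ F)
    (hint : ∀ p, fderiv ℝ F p (w p) = 0) {γ : ℝ → E} (hγ : ∀ t, HasDerivAt γ (w (γ t)) t)
    (s t : ℝ) : F (γ s) = F (γ t) := by
  have h (t : ℝ) : HasDerivAt (F ∘ γ) 0 t :=
    hint (γ t) ▸ (hF (γ t)).hasFDerivAt.comp_hasDerivAt t (hγ t)
  exact is_const_of_deriv_eq_zero (fun t ↦ (h t).differentiableAt) (fun t ↦ (h t).deriv) s t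

/-- Properness of a first integral implies completeness of the flow: if `v` is a C¹
vector field on ℝ^d and `F : ℝ^d → ℝ^m` is a C¹ proper map with `DF(p)(v(p)) = 0`
for all `p`, then through every point there is an integral curve of `v` defined on
all of ℝ. -/
theorem proper_first_integral_implies_complete_flow (d m : ℕ)
    (v : EuclideanSpace ℝ (Fin d) → EuclideanSpace ℝ (Fin d))
    (F : EuclideanSpace ℝ (Fin d) → EuclideanSpace ℝ (Fin m))
    (hv : ContDiff ℝ 1 v) (hF : ContDiff ℝ 1 F)
    (hproper : ∀ K : Set (EuclideanSpace ℝ (Fin m)), IsCompact K → IsCompact (F ⁻¹' K))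
    (hint : ∀ p, fderiv ℝ F p (v p) = 0) :
    ∀ p₀ : EuclideanSpace ℝ (Fin d), ∃ γ : ℝ → EuclideanSpace ℝ (Fin d),
      γ 0 = p₀ ∧ ∀ t : ℝ, HasDerivAt γ (v (γ t)) t := by
  intro p₀
  obtain ⟨R, hR, hKR⟩ :=
    (hproper {F p₀} isCompact_singleton).isBounded.subset_closedBall_lt 0 0
  -- Cut `v` off outside a ball containing the fibre of `F` through `p₀`.
  let χ : ContDiffBump (0 : EuclideanSpace ℝ (Fin d)) := ⟨R, R + 1, hR, lt_add_one R⟩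
  have hχ : HasCompactSupport fun p ↦ χ p • v p := χ.hasCompactSupport.smul_right
  obtain ⟨γ, hγ0, hγ⟩ := hχ.exists_forall_hasDerivAt_of_contDiff (χ.contDiff.smul hv) p₀
  refine ⟨γ, hγ0, fun t ↦ ?_⟩
  have hFγ : F (γ t) = F p₀ := hγ0 ▸ apply_eq_of_fderiv_apply_eq_zero (w := fun p ↦ χ p • v p)
    (hF.differentiable one_ne_zero) (fun p ↦ by simp [hint p]) hγ t 0
  have hone : χ (γ t) = 1 := χ.one_of_mem_closedBall (hKR hFγ)
  simpa only [hone, one_smul] using hγ t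
end
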